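/- For ξ ∈ ℝ³ with ξ₁² + ξ₂² + (ξ₃+1)² > 0 and ξ₁² + ξ₂² + (ξ₃-1)² > 0, setting η^±(ξ) = √(|ξ|² ± 2ξ₃ + 1) and λ^±(ξ) = (η⁺(ξ) ± η⁻(ξ))/2, the determinant of the Hessian of λ⁺ equals |ξ_h|²(η⁺(ξ)+η⁻(ξ)) / (2 η⁺(ξ)⁴ η⁻(ξ)⁴), where ξ_h = (ξ₁,ξ₂). -/

import Mathlib

noncomputable def pd (f : (Fin 3 → ℝ) → ℝ) (x : Fin 3 → ℝ) (k : Fin 3) : ℝ :=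
  fderiv ℝ f x (Pi.single k 1)

noncomputable def hess (f : (Fin 3 → ℝ) → ℝ) (x : Fin 3 → ℝ) : Matrix (Fin 3) (Fin 3) ℝ :=
  Matrix.of fun k l => pd (fun y => pd f y l) x k

noncomputable def etaP (ξ : Fin 3 → ℝ) : ℝ :=
  Real.sqrt (ξ 0 ^ 2 + ξ 1 ^ 2 + ξ 2 ^ 2 + 2 * ξ 2 + 1)

noncomputable def etaM (ξ : Fin 3 → ℝ) : ℝ :=
  Real.sqrt (ξ 0 ^ 2 + ξ 1 ^ 2 + ξ 2 ^ 2 - 2 * ξ 2 + 1)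

noncomputable def lamP (ξ : Fin 3 → ℝ) : ℝ := (etaP ξ + etaM ξ) / 2

/-- The Euclidean distance from `x` to `-c`. -/
noncomputable def shiftNorm (c x : Fin 3 → ℝ) : ℝ := Real.sqrt (∑ i, (x i + c i) ^ 2)

theorem hasFDerivAt_shiftNorm (c : Fin 3 → ℝ) {x : Fin 3 → ℝ} (hx : 0 < ∑ i, (x i + c i) ^ 2) :
    HasFDerivAt (shiftNorm c)
      (∑ i, ((x i + c i) / shiftNorm c x) • ContinuousLinearMap.proj (R := ℝ) (φ := fun _ => ℝ) i) x := by
  have hcoord (i : Fin 3) :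
      HasFDerivAt (fun y : Fin 3 → ℝ => y i + c i) (ContinuousLinearMap.proj (R := ℝ) (φ := fun _ => ℝ) i) x :=
    (hasFDerivAt_apply (𝕜 := ℝ) i x).add_const (c i)
  have hsum := HasFDerivAt.fun_sum (u := Finset.univ) fun i _ => (hcoord i).pow 2
  refine (hsum.sqrt hx.ne').congr_fderiv ?_
  rw [Finset.smul_sum]
  refine Finset.sum_congr rfl fun i _ => ?_
  ext v
  simp [shiftNorm]
  ring

theorem continuous_sum_add_sq (c : Fin 3 → ℝ) :
    Continuous fun x : Fin 3 → ℝ => ∑ i, (x i + c i) ^ 2 := by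
  fun_prop

theorem pd_eq_of_hasFDerivAt {f : (Fin 3 → ℝ) → ℝ} {x : Fin 3 → ℝ} {f' : (Fin 3 → ℝ) →L[ℝ] ℝ}
    (h : HasFDerivAt f f' x) (k : Fin 3) : pd f x k = f' (Pi.single k 1) := by
  rw [pd, h.fderiv]

theorem pd_shiftNorm (c : Fin 3 → ℝ) {x : Fin 3 → ℝ} (hx : 0 < ∑ i, (x i + c i) ^ 2)
    (k : Fin 3) : pd (shiftNorm c) x k = (x k + c k) / shiftNorm c x := by
  rw [pd_eq_of_hasFDerivAt (hasFDerivAt_shiftNorm c hx)]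
  simp [Pi.single_apply]

theorem shiftNorm_pos {c x : Fin 3 → ℝ} (hx : 0 < ∑ i, (x i + c i) ^ 2) : 0 < shiftNorm c x :=
  Real.sqrt_pos.2 hx

theorem hasFDerivAt_div_shiftNorm (c : Fin 3 → ℝ) {x : Fin 3 → ℝ}
    (hx : 0 < ∑ i, (x i + c i) ^ 2) (l : Fin 3) :
    HasFDerivAt (fun y => (y l + c l) / shiftNorm c y)
      ((x l + c l) • (-(shiftNorm c x ^ 2)⁻¹ •
          ∑ i, ((x i + c i) / shiftNorm c x) • ContinuousLinearMap.proj (R := ℝ) (φ := fun _ => ℝ) i) +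
        (shiftNorm c x)⁻¹ • ContinuousLinearMap.proj (R := ℝ) (φ := fun _ => ℝ) l) x := by
  have hnum : HasFDerivAt (fun y : Fin 3 → ℝ => y l + c l)
      (ContinuousLinearMap.proj (R := ℝ) (φ := fun _ => ℝ) l) x :=
    (hasFDerivAt_apply (𝕜 := ℝ) l x).add_const (c l)
  exact hnum.mul
    ((hasDerivAt_inv (shiftNorm_pos hx).ne').comp_hasFDerivAt x (hasFDerivAt_shiftNorm c hx))

theorem pd_div_shiftNorm (c : Fin 3 → ℝ) {x : Fin 3 → ℝ} (hx : 0 < ∑ i, (x i + c i) ^ 2)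
    (k l : Fin 3) :
    pd (fun y => (y l + c l) / shiftNorm c y) x k =
      (if k = l then 1 else 0) / shiftNorm c x -
        (x k + c k) * (x l + c l) / shiftNorm c x ^ 3 := by
  have hpos := shiftNorm_pos hx
  rw [pd_eq_of_hasFDerivAt (hasFDerivAt_div_shiftNorm c hx l)]
  have hsingle : (Pi.single k 1 : Fin 3 → ℝ) l = if k = l then 1 else 0 := by
    simp [Pi.single_apply, eq_comm]
  simp [hsingle]
  simp [Pi.single_apply]
  split_ifs <;> field_simp <;> ring

theorem pd_half_add {f g : (Fin 3 → ℝ) → ℝ} {x : Fin 3 → ℝ} (hf : DifferentiableAt ℝ f x)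
    (hg : DifferentiableAt ℝ g x) (k : Fin 3) :
    pd (fun y => (f y + g y) / 2) x k = (pd f x k + pd g x k) / 2 := by
  simp only [pd, div_eq_mul_inv]
  rw [fderiv_mul_const (hf.fun_add hg), fderiv_fun_add hf hg]
  simp
  ring

theorem hess_half_add_shiftNorm (c d : Fin 3 → ℝ) {x : Fin 3 → ℝ}
    (hc : 0 < ∑ i, (x i + c i) ^ 2) (hd : 0 < ∑ i, (x i + d i) ^ 2) (k l : Fin 3) :
    hess (fun y => (shiftNorm c y + shiftNorm d y) / 2) x k l =
      (((if k = l then 1 else 0) / shiftNorm c x -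
          (x k + c k) * (x l + c l) / shiftNorm c x ^ 3) +
        ((if k = l then 1 else 0) / shiftNorm d x -
          (x k + d k) * (x l + d l) / shiftNorm d x ^ 3)) / 2 := by
  have hgrad : (fun y => pd (fun z => (shiftNorm c z + shiftNorm d z) / 2) y l) =ᶠ[nhds x]
      fun y => ((y l + c l) / shiftNorm c y + (y l + d l) / shiftNorm d y) / 2 := by
    filter_upwards [(continuous_sum_add_sq c).continuousAt.eventually_const_lt hc,
      (continuous_sum_add_sq d).continuousAt.eventually_const_lt hd] with y hyc hyd
    rw [pd_half_add (hasFDerivAt_shiftNorm c hyc).differentiableAt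
      (hasFDerivAt_shiftNorm d hyd).differentiableAt, pd_shiftNorm c hyc, pd_shiftNorm d hyd]
  rw [← pd_div_shiftNorm c hc, ← pd_div_shiftNorm d hd,
    ← pd_half_add (hasFDerivAt_div_shiftNorm c hc l).differentiableAt
      (hasFDerivAt_div_shiftNorm d hd l).differentiableAt]
  simp only [hess, Matrix.of_apply]
  rw [pd, hgrad.fderiv_eq, pd]

theorem etaP_eq_shiftNorm : etaP = shiftNorm ![0, 0, 1] := by
  ext x
  simp only [etaP, shiftNorm, Fin.sum_univ_three]
  congr 1
  simp
  ring

theorem etaM_eq_shiftNorm : etaM = shiftNorm ![0, 0, -1] := by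
  ext x
  simp only [etaM, shiftNorm, Fin.sum_univ_three]
  congr 1
  simp
  ring

theorem det_hess_lamP (ξ : Fin 3 → ℝ)
    (h1 : 0 < ξ 0 ^ 2 + ξ 1 ^ 2 + (ξ 2 + 1) ^ 2)
    (h2 : 0 < ξ 0 ^ 2 + ξ 1 ^ 2 + (ξ 2 - 1) ^ 2) :
    (hess lamP ξ).det =
      (ξ 0 ^ 2 + ξ 1 ^ 2) * (etaP ξ + etaM ξ) / (2 * etaP ξ ^ 4 * etaM ξ ^ 4) := by
  have hc : 0 < ∑ i, (ξ i + (![0, 0, 1] : Fin 3 → ℝ) i) ^ 2 := by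
    simpa [Fin.sum_univ_three] using h1
  have hd : 0 < ∑ i, (ξ i + (![0, 0, -1] : Fin 3 → ℝ) i) ^ 2 := by
    simpa [Fin.sum_univ_three, ← sub_eq_add_neg] using h2
  have hlam : lamP = fun y => (shiftNorm ![0, 0, 1] y + shiftNorm ![0, 0, -1] y) / 2 := by
    ext y
    rw [lamP, etaP_eq_shiftNorm, etaM_eq_shiftNorm]
  rw [Matrix.det_fin_three, hlam]
  simp only [hess_half_add_shiftNorm _ _ hc hd]
  rw [etaP_eq_shiftNorm, etaM_eq_shiftNorm]
  have ha := shiftNorm_pos hc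
  have hb := shiftNorm_pos hd
  have ha2 : shiftNorm ![0, 0, 1] ξ ^ 2 = ξ 0 ^ 2 + ξ 1 ^ 2 + (ξ 2 + 1) ^ 2 := by
    rw [shiftNorm, Real.sq_sqrt hc.le]
    simp [Fin.sum_univ_three]
  have hb2 : shiftNorm ![0, 0, -1] ξ ^ 2 = ξ 0 ^ 2 + ξ 1 ^ 2 + (ξ 2 - 1) ^ 2 := by
    rw [shiftNorm, Real.sq_sqrt hd.le]
    simp [Fin.sum_univ_three, ← sub_eq_add_neg]
  generalize shiftNorm ![0, 0, 1] ξ = a at *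
  generalize shiftNorm ![0, 0, -1] ξ = b at *
  have hp : (ξ 0 ^ 2 + ξ 1 ^ 2 + (ξ 2 + 1) ^ 2) * (a ^ 3)⁻¹ = a⁻¹ := by
    rw [← ha2]
    field_simp
  have hq : (ξ 0 ^ 2 + ξ 1 ^ 2 + (ξ 2 - 1) ^ 2) * (b ^ 3)⁻¹ = b⁻¹ := by
    rw [← hb2]
    field_simp
  have hrhs : (ξ 0 ^ 2 + ξ 1 ^ 2) * (a + b) / (2 * a ^ 4 * b ^ 4) =
      (ξ 0 ^ 2 + ξ 1 ^ 2) * (a⁻¹ + b⁻¹) * (a ^ 3)⁻¹ * (b ^ 3)⁻¹ / 2 := by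
    field_simp
    ring
  rw [hrhs]
  simp [div_eq_mul_inv, -inv_pow]
  generalize (a ^ 3)⁻¹ = p at *
  generalize (b ^ 3)⁻¹ = q at *
  generalize a⁻¹ = s at *
  generalize b⁻¹ = t at *
  linear_combination (-(s + t) ^ 2 / 8) * (hp + hq)
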